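/- arXiv:1105.3451 — 5 statements merged into one kernel-verified Lean document; each statement's English description precedes it below -/
import Mathlib

section
/- For every real $t$ with $0 < t \le \sqrt{1/2}$, setting $\alpha = \frac{2\sqrt{1-t^2}}{1+\sqrt{1-t^2}}$ and $s = \left(\frac{1+\sqrt{1-2t^2}}{2t}\right)^2$, one has $(1-\alpha)\, s \le \frac{1}{4}$. In particular $\beta := 1 - (1-\alpha)s$ lies in $[3/4, 1]$, so it is a valid measurement parameter. -/
theorem stmt_4 (t : ℝ) (ht0 : 0 < t) (ht1 : t ≤ Real.sqrt (1 / 2)) :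
    let α := 2 * Real.sqrt (1 - t ^ 2) / (1 + Real.sqrt (1 - t ^ 2))
    let s := ((1 + Real.sqrt (1 - 2 * t ^ 2)) / (2 * t)) ^ 2
    (1 - α) * s ≤ 1 / 4 ∧ 1 - (1 - α) * s ∈ Set.Icc (3 / 4 : ℝ) 1 := by
  intro α s
  have ht2 : t ^ 2 ≤ 1 / 2 := (Real.le_sqrt ht0.le (by norm_num)).mp ht1
  have hba : Real.sqrt (1 - 2 * t ^ 2) ≤ Real.sqrt (1 - t ^ 2) :=
    Real.sqrt_le_sqrt (by nlinarith [sq_nonneg t])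
  have ha2 : Real.sqrt (1 - t ^ 2) ^ 2 = 1 - t ^ 2 := Real.sq_sqrt (by linarith)
  have hb : 0 ≤ Real.sqrt (1 - 2 * t ^ 2) := Real.sqrt_nonneg _
  have key : (1 - α) * s =
      ((1 + Real.sqrt (1 - 2 * t ^ 2)) / (1 + Real.sqrt (1 - t ^ 2))) ^ 2 / 4 := by
    simp only [α, s]
    generalize Real.sqrt (1 - t ^ 2) = a at *
    generalize Real.sqrt (1 - 2 * t ^ 2) = b at *
    have ha : 1 + a ≠ 0 := by linarith
    have hα : 1 - 2 * a / (1 + a) = t ^ 2 / (1 + a) ^ 2 := by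
      field_simp
      linear_combination -ha2
    rw [hα]
    field_simp
    norm_num
  have hle : ((1 + Real.sqrt (1 - 2 * t ^ 2)) / (1 + Real.sqrt (1 - t ^ 2))) ^ 2 ≤ 1 :=
    pow_le_one₀ (by positivity) (div_le_one_of_le₀ (by linarith) (by positivity))
  have hnonneg := sq_nonneg ((1 + Real.sqrt (1 - 2 * t ^ 2)) / (1 + Real.sqrt (1 - t ^ 2)))
  rw [key]
  refine ⟨?_, ?_, ?_⟩ <;> linarith
end

section
/- Let $I$ be a finite index set, let $t \ge 0$, $s \in \mathbb{R}$, $q_{AB} \in [0,1]$, and let $q_i \ge 0$, $a_i \ge 0$, $b_i \ge 0$ for $i \in I$ satisfy: (i) $q_{AB} + \sum_{i} q_i = 1$; (ii) $\frac{1-s}{2} = \frac{q_{AB}}{2} + \sum_i q_i a_i$; (iii) $s = \sum_i q_i b_i$; and (iv) $2\sqrt{a_i b_i} \ge t$ for all $i \in I$. Then $\sqrt{2(1 - s - q_{AB})\, s} \ge (1 - q_{AB})\, t$. -/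
theorem stmt_5 {I : Type*} [Fintype I] (t s qAB : ℝ) (q a b : I → ℝ)
    (ht : 0 ≤ t) (hqAB : qAB ∈ Set.Icc (0 : ℝ) 1)
    (hq : ∀ i, 0 ≤ q i) (ha : ∀ i, 0 ≤ a i) (hb : ∀ i, 0 ≤ b i)
    (hnorm : qAB + ∑ i, q i = 1)
    (hinv1 : (1 - s) / 2 = qAB / 2 + ∑ i, q i * a i)
    (hinv2 : s = ∑ i, q i * b i)
    (hCa : ∀ i, 2 * Real.sqrt (a i * b i) ≥ t) :
    Real.sqrt (2 * (1 - s - qAB) * s) ≥ (1 - qAB) * t := by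
  have cauchy : (∑ i, q i * √(a i * b i)) ^ 2 ≤ (∑ i, q i * a i) * ∑ i, q i * b i := by
    refine Finset.sum_sq_le_sum_mul_sum_of_sq_le_mul _ (fun i _ => mul_nonneg (hq i) (ha i))
      (fun i _ => mul_nonneg (hq i) (hb i)) fun i _ => le_of_eq ?_
    rw [mul_pow, Real.sq_sqrt (mul_nonneg (ha i) (hb i))]
    ring
  have average : (1 - qAB) * t ≤ 2 * ∑ i, q i * √(a i * b i) := by
    rw [show 1 - qAB = ∑ i, q i by linarith, Finset.sum_mul, Finset.mul_sum]
    refine Finset.sum_le_sum fun i _ => ?_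
    linarith [mul_le_mul_of_nonneg_left (hCa i) (hq i)]
  rw [← hinv2] at cauchy
  refine average.trans (Real.le_sqrt_of_sq_le ?_)
  rw [show 1 - s - qAB = 2 * ∑ i, q i * a i by linarith]
  linarith
end

section
/- Let $I$ be a finite index set, let $t \ge 0$, $s \in \mathbb{R}$, $q_{AB} \in [0,1)$, and let $q_i \ge 0$, $a_i \ge 0$, $b_i \ge 0$ for $i \in I$ satisfy: (i) $q_{AB} + \sum_{i} q_i = 1$; (ii) $\frac{1-s}{2} = \frac{q_{AB}}{2} + \sum_i q_i a_i$; (iii) $s = \sum_i q_i b_i$; and (iv) $2\sqrt{a_i b_i} \ge t$ for all $i \in I$. Then, setting $s' = \frac{s}{1-q_{AB}}$, one has $\sqrt{2 s' (1 - s')} \ge t$. -/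
theorem stmt_6 {I : Type*} [Fintype I] (t s qAB : ℝ) (q a b : I → ℝ)
    (ht : 0 ≤ t) (hqAB : qAB ∈ Set.Ico (0 : ℝ) 1)
    (hq : ∀ i, 0 ≤ q i) (ha : ∀ i, 0 ≤ a i) (hb : ∀ i, 0 ≤ b i)
    (hnorm : qAB + ∑ i, q i = 1)
    (hinv1 : (1 - s) / 2 = qAB / 2 + ∑ i, q i * a i)
    (hinv2 : s = ∑ i, q i * b i)
    (hCa : ∀ i, 2 * Real.sqrt (a i * b i) ≥ t) :
    let s' := s / (1 - qAB)
    Real.sqrt (2 * s' * (1 - s')) ≥ t := by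
  intro s'
  have hQ : 0 < 1 - qAB := sub_pos.2 hqAB.2
  have hA : 0 ≤ ∑ i, q i * a i := Finset.sum_nonneg fun i _ ↦ mul_nonneg (hq i) (ha i)
  have h_cs : (1 - qAB) * (t / 2) ≤ √(∑ i, q i * a i) * √(∑ i, q i * b i) :=
    calc (1 - qAB) * (t / 2) = ∑ i, q i * (t / 2) := by
          rw [← Finset.sum_mul, ← hnorm, add_sub_cancel_left]
      _ ≤ ∑ i, √(q i * a i) * √(q i * b i) := by
          refine Finset.sum_le_sum fun i _ ↦ ?_
          rw [← Real.sqrt_mul (mul_nonneg (hq i) (ha i)), mul_mul_mul_comm,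
            Real.sqrt_mul (mul_self_nonneg _), Real.sqrt_mul_self (hq i)]
          exact mul_le_mul_of_nonneg_left (by linarith [hCa i]) (hq i)
      _ ≤ _ := Real.sum_sqrt_mul_sqrt_le _ (fun i ↦ mul_nonneg (hq i) (ha i))
          fun i ↦ mul_nonneg (hq i) (hb i)
  rw [← hinv2, ← Real.sqrt_mul hA] at h_cs
  have h_eq : 2 * s' * (1 - s') = (2 / (1 - qAB)) ^ 2 * ((∑ i, q i * a i) * s) := by
    have hA' : ∑ i, q i * a i = (1 - qAB - s) / 2 := by linarith
    simp only [s', hA']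
    field_simp
  rw [h_eq, Real.sqrt_mul (sq_nonneg _), Real.sqrt_sq (by positivity), ge_iff_le, div_mul_eq_mul_div,
    le_div_iff₀ hQ]
  linarith
end

section
/- Let $t \in (0, \sqrt{1/2}]$ be real, let $\alpha = \frac{2\sqrt{1-t^2}}{1+\sqrt{1-t^2}}$ and $s = \left(\frac{1+\sqrt{1-2t^2}}{2t}\right)^2$. Let $H = $ EuclideanSpace $\mathbb{C}$ (Fin 2 × Fin 2 × Fin 2), with standard basis vectors $e_{(a,b,c)}$, and let $\phi_{2,2} = \frac{1}{\sqrt{3-\alpha}}\left(e_{(1,0,0)} + \sqrt{1-\alpha}\, e_{(0,1,0)} + e_{(0,0,1)}\right)$. Define $v \in H$ by $v(a,0,c) = \sqrt{(1-\alpha)s}\; \phi_{2,2}(a,0,c)$ and $v(a,1,c) = \phi_{2,2}(a,1,c)$. Then $\frac{v}{\|v\|} = \frac{1}{\sqrt{1+2s}}\left(\sqrt{s}\, e_{(1,0,0)} + e_{(0,1,0)} + \sqrt{s}\, e_{(0,0,1)}\right)$. -/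
/-- The Hilbert space of three qubits (Alice, Bob, Charlie). -/
noncomputable abbrev ThreeQubits : Type := EuclideanSpace ℂ (Fin 2 × Fin 2 × Fin 2)

/-- Standard basis vector `|abc⟩`. -/
noncomputable def ket (i : Fin 2 × Fin 2 × Fin 2) : ThreeQubits :=
  EuclideanSpace.single i 1

/-- The state `|φ₂,₂⟩` obtained after outcome 2 of Alice's round-2 measurement. -/
noncomputable def phi22 (α : ℝ) : ThreeQubits :=
  (Real.sqrt (3 - α))⁻¹ •
    (ket (1, 0, 0) + Real.sqrt (1 - α) • ket (0, 1, 0) + ket (0, 0, 1))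

theorem one_sub_two_mul_div_one_add_pos {w : ℝ} (hw : 0 ≤ w) (hw1 : w < 1) :
    0 < 1 - 2 * w / (1 + w) := by
  have h : 1 - 2 * w / (1 + w) = (1 - w) / (1 + w) := by
    field_simp
    ring
  rw [h]
  exact div_pos (by linarith) (by linarith)

theorem norm_ket_add_ket_add_ket {s : ℝ} (hs : 0 ≤ s) :
    ‖Real.sqrt s • ket (1, 0, 0) + ket (0, 1, 0) + Real.sqrt s • ket (0, 0, 1)‖ =
      Real.sqrt (1 + 2 * s) := by
  rw [EuclideanSpace.norm_eq]
  congr 1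
  simp [Fintype.sum_prod_type, ket, Real.sq_sqrt hs]
  ring

/-- Positive multiples have the same normalization. -/
theorem inv_norm_smul_smul_of_pos {E : Type*} [NormedAddCommGroup E] [NormedSpace ℝ E]
    {k : ℝ} (hk : 0 < k) (u : E) : ‖k • u‖⁻¹ • (k • u) = ‖u‖⁻¹ • u := by
  rw [norm_smul, Real.norm_of_nonneg hk.le, smul_smul, mul_inv_rev, mul_assoc,
    inv_mul_cancel₀ hk.ne', mul_one]

theorem stmt_16 (t : ℝ) (ht : t ∈ Set.Ioc (0 : ℝ) (Real.sqrt (1 / 2))) (v : ThreeQubits)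
    (α : ℝ) (hα : α = 2 * Real.sqrt (1 - t ^ 2) / (1 + Real.sqrt (1 - t ^ 2)))
    (s : ℝ) (hs : s = ((1 + Real.sqrt (1 - 2 * t ^ 2)) / (2 * t)) ^ 2)
    (hv0 : ∀ a c : Fin 2,
      v (a, 0, c) = (Real.sqrt ((1 - α) * s) : ℂ) * phi22 α (a, 0, c))
    (hv1 : ∀ a c : Fin 2, v (a, 1, c) = phi22 α (a, 1, c)) :
    ‖v‖⁻¹ • v =
      (Real.sqrt (1 + 2 * s))⁻¹ •
        (Real.sqrt s • ket (1, 0, 0) + ket (0, 1, 0) + Real.sqrt s • ket (0, 0, 1)) := by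
  have hα1 : 0 < 1 - α := by
    rw [hα]
    refine one_sub_two_mul_div_one_add_pos (Real.sqrt_nonneg _) ?_
    rw [Real.sqrt_lt' one_pos]
    nlinarith [sq_pos_of_pos ht.1]
  have hs0 : 0 ≤ s := hs ▸ sq_nonneg _
  have hk : 0 < (Real.sqrt (3 - α))⁻¹ * Real.sqrt (1 - α) :=
    mul_pos (inv_pos.2 (Real.sqrt_pos.2 (by linarith))) (Real.sqrt_pos.2 hα1)
  have hv : v = ((Real.sqrt (3 - α))⁻¹ * Real.sqrt (1 - α)) •
      (Real.sqrt s • ket (1, 0, 0) + ket (0, 1, 0) + Real.sqrt s • ket (0, 0, 1)) := by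
    ext ⟨a, b, c⟩
    fin_cases b
    · refine (hv0 a c).trans ?_
      rw [Real.sqrt_mul hα1.le]
      fin_cases a <;> fin_cases c <;> simp [phi22, ket] <;> ring
    · refine (hv1 a c).trans ?_
      fin_cases a <;> fin_cases c <;> simp [phi22, ket]
  rw [hv, inv_norm_smul_smul_of_pos hk, norm_ket_add_ket_add_ket hs0]
end

section
/- Let $\alpha \in (0,1)$ be real. Let $H = $ EuclideanSpace $\mathbb{C}$ (Fin 2 × Fin 2 × Fin 2), with standard basis vectors $e_{(a,b,c)}$, let $W = \frac{1}{\sqrt{3}}\left(e_{(1,0,0)} + e_{(0,1,0)} + e_{(0,0,1)}\right)$, and let $\phi_{2,2} = \frac{1}{\sqrt{3-\alpha}}\left(e_{(1,0,0)} + \sqrt{1-\alpha}\, e_{(0,1,0)} + e_{(0,0,1)}\right)$. Define $v_1 \in H$ by $v_1(a,0,c) = \sqrt{\alpha}\, \phi_{2,2}(a,0,c)$, $v_1(a,1,c) = 0$, and $v_2 \in H$ by $v_2(a,0,c) = \sqrt{1-\alpha}\, \phi_{2,2}(a,0,c)$, $v_2(a,1,c) = \phi_{2,2}(a,1,c)$.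 Then $\|v_1\|^2 = \frac{2\alpha}{3-\alpha}$ with $\frac{v_1}{\|v_1\|} = \frac{1}{\sqrt{2}}\left(e_{(1,0,0)} + e_{(0,0,1)}\right)$, and $\|v_2\|^2 = \frac{3(1-\alpha)}{3-\alpha}$ with $\frac{v_2}{\|v_2\|} = W$. -/
/-- The three-qubit W state. -/
noncomputable def Wstate : ThreeQubits :=
  (Real.sqrt 3)⁻¹ • (ket (1, 0, 0) + ket (0, 1, 0) + ket (0, 0, 1))

/-- Norm and normalization of a positive multiple of a vector with known squared norm. -/
theorem norm_sq_and_normalize_of_eq_smul {E : Type*} [NormedAddCommGroup E] [NormedSpace ℝ E]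
    {v w : E} {c n : ℝ} (hc : 0 < c) (hw : ‖w‖ ^ 2 = n) (hv : v = c • w) :
    ‖v‖ ^ 2 = c ^ 2 * n ∧ ‖v‖⁻¹ • v = (Real.sqrt n)⁻¹ • w := by
  subst hv hw
  rw [norm_smul, Real.norm_of_nonneg hc.le, Real.sqrt_sq (norm_nonneg w), smul_smul]
  refine ⟨by ring, ?_⟩
  congr 1
  rw [mul_inv, mul_right_comm, inv_mul_cancel₀ hc.ne', one_mul]

theorem norm_sq_ket_add_ket :
    ‖ket (1, 0, 0) + ket (0, 0, 1)‖ ^ 2 = 2 := by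
  rw [EuclideanSpace.norm_sq_eq]
  simp [Fintype.sum_prod_type, ket]
  norm_num

theorem norm_sq_ket_add_ket_add_ket :
    ‖ket (1, 0, 0) + ket (0, 1, 0) + ket (0, 0, 1)‖ ^ 2 = 3 := by
  rw [EuclideanSpace.norm_sq_eq]
  simp [Fintype.sum_prod_type, ket]
  norm_num

theorem stmt_17 (α : ℝ) (hα : α ∈ Set.Ioo (0 : ℝ) 1) (v₁ v₂ : ThreeQubits)
    (hv₁0 : ∀ a c : Fin 2, v₁ (a, 0, c) = (Real.sqrt α : ℂ) * phi22 α (a, 0, c))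
    (hv₁1 : ∀ a c : Fin 2, v₁ (a, 1, c) = 0)
    (hv₂0 : ∀ a c : Fin 2, v₂ (a, 0, c) = (Real.sqrt (1 - α) : ℂ) * phi22 α (a, 0, c))
    (hv₂1 : ∀ a c : Fin 2, v₂ (a, 1, c) = phi22 α (a, 1, c)) :
    (‖v₁‖ ^ 2 = 2 * α / (3 - α) ∧
        ‖v₁‖⁻¹ • v₁ = (Real.sqrt 2)⁻¹ • (ket (1, 0, 0) + ket (0, 0, 1))) ∧
      ‖v₂‖ ^ 2 = 3 * (1 - α) / (3 - α) ∧ ‖v₂‖⁻¹ • v₂ = Wstate := by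
  obtain ⟨h0, h1⟩ := hα
  have hα' : 0 < 1 - α := by linarith
  have h3 : 0 < 3 - α := by linarith
  have e₁ : v₁ = (Real.sqrt α * (Real.sqrt (3 - α))⁻¹) • (ket (1, 0, 0) + ket (0, 0, 1)) := by
    ext ⟨a, b, c⟩
    fin_cases b
    · refine (hv₁0 a c).trans ?_
      fin_cases a <;> fin_cases c <;> simp [phi22, ket]
    · refine (hv₁1 a c).trans ?_
      simp [ket]
  have e₂ : v₂ = (Real.sqrt (1 - α) * (Real.sqrt (3 - α))⁻¹) •
      (ket (1, 0, 0) + ket (0, 1, 0) + ket (0, 0, 1)) := by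
    ext ⟨a, b, c⟩
    fin_cases b
    · refine (hv₂0 a c).trans ?_
      fin_cases a <;> fin_cases c <;> simp [phi22, ket]
    · refine (hv₂1 a c).trans ?_
      fin_cases a <;> fin_cases c <;> simp [phi22, ket, mul_comm]
  obtain ⟨n₁, u₁⟩ := norm_sq_and_normalize_of_eq_smul (by positivity) norm_sq_ket_add_ket e₁
  obtain ⟨n₂, u₂⟩ :=
    norm_sq_and_normalize_of_eq_smul (by positivity) norm_sq_ket_add_ket_add_ket e₂
  refine ⟨⟨?_, u₁⟩, ?_, u₂⟩
  · rw [n₁, mul_pow, inv_pow, Real.sq_sqrt h0.le, Real.sq_sqrt h3.le]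
    ring
  · rw [n₂, mul_pow, inv_pow, Real.sq_sqrt hα'.le, Real.sq_sqrt h3.le]
    ring
end
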